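/- Let λ ∈ ℝ^m with λ ⪰ 0, let ε ∈ ℝ^m be such that μ := λ + ε ⪰ 0, and let x* ∈ argmin_{x∈X} L(x, μ). Then 0 ≤ L(x*, λ) − h(λ) ≤ 2‖ε‖₂ σ_g, where σ_g := max_{x∈X} ‖g(x)‖₂. That is, exactly minimizing the Lagrangian at the perturbed multiplier μ = λ + ε produces a point that minimizes the Lagrangian at λ up to an additive error of at most 2‖ε‖₂ σ_g. -/

import Mathlib

open Finset

/-- The Lagrangian `L(x, λ) = f(x) + λᵀ g(x)`. -/
noncomputable def lagr0 {n m : ℕ} (f : EuclideanSpace ℝ (Fin n) → ℝ)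
    (g : EuclideanSpace ℝ (Fin n) → EuclideanSpace ℝ (Fin m))
    (x : EuclideanSpace ℝ (Fin n)) (lam : EuclideanSpace ℝ (Fin m)) : ℝ :=
  f x + ∑ j, lam j * g x j

/-- The Lagrange dual function `h(λ) = min_{x ∈ X} L(x, λ)`. -/
noncomputable def dualFn0 {n m : ℕ} (X : Set (EuclideanSpace ℝ (Fin n)))
    (f : EuclideanSpace ℝ (Fin n) → ℝ)
    (g : EuclideanSpace ℝ (Fin n) → EuclideanSpace ℝ (Fin m))
    (lam : EuclideanSpace ℝ (Fin m)) : ℝ :=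
  sInf ((fun x => lagr0 f g x lam) '' X)

/-- Perturbing the multiplier by `ε` adds `⟪ε, g x⟫` to the Lagrangian. -/
theorem lagr0_add {n m : ℕ} (f : EuclideanSpace ℝ (Fin n) → ℝ)
    (g : EuclideanSpace ℝ (Fin n) → EuclideanSpace ℝ (Fin m))
    (x : EuclideanSpace ℝ (Fin n)) (lam ε : EuclideanSpace ℝ (Fin m)) :
    lagr0 f g x (lam + ε) = lagr0 f g x lam + inner ℝ ε (g x) := by
  simp only [lagr0, PiLp.add_apply, add_mul, sum_add_distrib, PiLp.inner_apply,
    RCLike.inner_apply, conj_trivial, add_assoc, mul_comm (g x _)]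

theorem continuous_lagr0 {n m : ℕ} {f : EuclideanSpace ℝ (Fin n) → ℝ}
    {g : EuclideanSpace ℝ (Fin n) → EuclideanSpace ℝ (Fin m)}
    (hf : Continuous f) (hg : Continuous g) (lam : EuclideanSpace ℝ (Fin m)) :
    Continuous fun x => lagr0 f g x lam := by
  unfold lagr0
  fun_prop

/-- Minimizing the Lagrangian at a perturbed multiplier `μ = λ + ε` approximately
minimizes the Lagrangian at `λ`: `0 ≤ L(x*, λ) - h(λ) ≤ 2 ‖ε‖₂ σ_g`. -/
theorem approx_lagrangian_minimization {n m : ℕ}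
    (X : Set (EuclideanSpace ℝ (Fin n))) (hXne : X.Nonempty) (hXcomp : IsCompact X)
    (hXconv : Convex ℝ X)
    (f : EuclideanSpace ℝ (Fin n) → ℝ) (hf : ConvexOn ℝ Set.univ f) (hfc : Continuous f)
    (g : EuclideanSpace ℝ (Fin n) → EuclideanSpace ℝ (Fin m))
    (hg : ∀ j, ConvexOn ℝ Set.univ fun x => g x j) (hgc : Continuous g)
    (σg : ℝ) (hσg : IsGreatest ((fun x => ‖g x‖) '' X) σg)
    (lam ε : EuclideanSpace ℝ (Fin m))
    (hlam : ∀ j, 0 ≤ lam j) (hpos : ∀ j, 0 ≤ lam j + ε j)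
    (xstar : EuclideanSpace ℝ (Fin n)) (hxstarX : xstar ∈ X)
    (hxstar : ∀ y ∈ X, lagr0 f g xstar (lam + ε) ≤ lagr0 f g y (lam + ε)) :
    0 ≤ lagr0 f g xstar lam - dualFn0 X f g lam ∧
      lagr0 f g xstar lam - dualFn0 X f g lam ≤ 2 * ‖ε‖ * σg := by
  have hbdd : BddBelow ((fun x => lagr0 f g x lam) '' X) :=
    (hXcomp.image (continuous_lagr0 hfc hgc lam)).bddBelow
  refine ⟨sub_nonneg.2 (csInf_le hbdd (Set.mem_image_of_mem _ hxstarX)), ?_⟩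
  have hinner : ∀ x ∈ X, |inner ℝ ε (g x)| ≤ ‖ε‖ * σg := fun x hx =>
    (abs_real_inner_le_norm _ _).trans
      (mul_le_mul_of_nonneg_left (hσg.2 (Set.mem_image_of_mem _ hx)) (norm_nonneg ε))
  rw [sub_le_comm]
  refine le_csInf (hXne.image _) ?_
  rintro _ ⟨y, hy, rfl⟩
  have hmin := hxstar y hy
  rw [lagr0_add, lagr0_add] at hmin
  have hlow := (abs_le.1 (hinner xstar hxstarX)).1
  have hupp := (abs_le.1 (hinner y hy)).2
  dsimp only
  linarith
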